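/- Let T ⊆ V be the set of 24 Hurwitz units and let p = ½(φ⁻¹ + φ·i + j) ∈ V, a quaternion of multiplicative order 5. Then the five sets T·p^k = {t * p^k : t ∈ T} for k = 0, 1, 2, 3, 4 are pairwise disjoint, their union is V, and each of them is an independent set in the 600-cell graph Σ (no two of its elements are adjacent). Consequently, assigning to each v ∈ V the unique k with v ∈ T·p^k is a proper 5-coloring of Σ. -/

import Mathlib

/-- The golden ratio. -/
noncomputable def gr : ℝ := (1 + Real.sqrt 5) / 2

/-- The coefficient 4-tuple of a quaternion with respect to the basis (1, i, j, k). -/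
def coords (q : Quaternion ℝ) : Fin 4 → ℝ := ![q.re, q.imI, q.imJ, q.imK]

/-- `x` is a sign, i.e. `x = ±1`. -/
def IsSign (x : ℝ) : Prop := x = 1 ∨ x = -1

/-- The 120 vertices of the regular 600-cell of circumradius 1: the eight unit quaternions
`±1, ±i, ±j, ±k`, the sixteen quaternions `½(±1 ± i ± j ± k)`, and the ninety-six quaternions
whose coefficient 4-tuple is an even permutation of `(±φ/2, ±1/2, ±1/(2φ), 0)`. -/
noncomputable def V600 : Set (Quaternion ℝ) :=
  {q | (∃ ε : ℝ, IsSign ε ∧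
          (coords q = ![ε, 0, 0, 0] ∨ coords q = ![0, ε, 0, 0] ∨
           coords q = ![0, 0, ε, 0] ∨ coords q = ![0, 0, 0, ε])) ∨
       (∃ ε₀ ε₁ ε₂ ε₃ : ℝ, IsSign ε₀ ∧ IsSign ε₁ ∧ IsSign ε₂ ∧ IsSign ε₃ ∧
          coords q = ![ε₀ / 2, ε₁ / 2, ε₂ / 2, ε₃ / 2]) ∨
       (∃ ε₁ ε₂ ε₃ : ℝ, IsSign ε₁ ∧ IsSign ε₂ ∧ IsSign ε₃ ∧
          ∃ σ : Equiv.Perm (Fin 4), Equiv.Perm.sign σ = 1 ∧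
            coords q = ![ε₁ * gr / 2, ε₂ / 2, ε₃ / (2 * gr), 0] ∘ σ)}

/-- The 600-cell graph: distinct vertices are adjacent iff their distance is `φ - 1`. -/
noncomputable def sigma600 : SimpleGraph V600 :=
  SimpleGraph.fromRel fun q q' => ‖(q : Quaternion ℝ) - (q' : Quaternion ℝ)‖ = gr - 1


/-- The 24 Hurwitz units `±1, ±i, ±j, ±k, ½(±1 ± i ± j ± k)` (the binary tetrahedral
group `𝒯`). -/
def hurwitzUnits : Set (Quaternion ℝ) :=
  {q | (∃ ε : ℝ, IsSign ε ∧
          (coords q = ![ε, 0, 0, 0] ∨ coords q = ![0, ε, 0, 0] ∨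
           coords q = ![0, 0, ε, 0] ∨ coords q = ![0, 0, 0, ε])) ∨
       (∃ ε₀ ε₁ ε₂ ε₃ : ℝ, IsSign ε₀ ∧ IsSign ε₁ ∧ IsSign ε₂ ∧ IsSign ε₃ ∧
          coords q = ![ε₀ / 2, ε₁ / 2, ε₂ / 2, ε₃ / 2])}

/-- The quaternion `p = ½(φ⁻¹ + φ·i + j)`, an element of `V600` of multiplicative
order 5. -/
noncomputable def p600 : Quaternion ℝ := ⟨gr⁻¹ / 2, gr / 2, 1 / 2, 0⟩

/-- The right coset `𝒯·p^k` of the Hurwitz units. -/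
noncomputable def coset600 (k : Fin 5) : Set (Quaternion ℝ) :=
  (fun t => t * p600 ^ (k : ℕ)) '' hurwitzUnits

open Quaternion

/-- The ring `ℤ[φ]` of golden integers, with decidable equality. -/
abbrev GoldenInt := QuadraticAlgebra ℤ 1 1

namespace GoldenInt

theorem gr_irrational : Irrational gr := Real.goldenRatio_irrational

theorem gr_mul_self : gr * gr = 1 + gr := by
  rw [← sq, add_comm]
  exact Real.goldenRatio_sq

theorem inv_gr : gr⁻¹ = gr - 1 :=
  inv_eq_of_mul_eq_one_right (by linear_combination gr_mul_self)

/-- The embedding of `ℤ[φ]` into the reals. -/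
noncomputable def toReal : GoldenInt →+* ℝ where
  toFun a := a.re + a.im * gr
  map_zero' := by simp
  map_one' := by
    change ((1 : ℤ) : ℝ) + ((0 : ℤ) : ℝ) * gr = 1
    simp
  map_add' a b := by push_cast [QuadraticAlgebra.re_add, QuadraticAlgebra.im_add]; ring
  map_mul' a b := by simp; linear_combination (-a.im * b.im : ℝ) * gr_mul_self

theorem toReal_apply (a : GoldenInt) : toReal a = a.re + a.im * gr := rfl

theorem toReal_mk (m n : ℤ) : toReal ⟨m, n⟩ = m + n * gr := rfl

theorem toReal_injective : Function.Injective toReal := by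
  rw [injective_iff_map_eq_zero]
  intro a ha
  rw [toReal_apply] at ha
  have him : a.im = 0 := by
    by_contra h
    refine ((gr_irrational.intCast_mul h).intCast_add a.re).ne_zero ha
  have hre : a.re = 0 := by simpa [him] using ha
  exact QuadraticAlgebra.ext hre him

end GoldenInt

namespace Quaternion

instance {R : Type*} [Zero R] [One R] [Neg R] [DecidableEq R] : DecidableEq ℍ[R] := fun x y =>
  decidable_of_iff (x.re = y.re ∧ x.imI = y.imI ∧ x.imJ = y.imJ ∧ x.imK = y.imK)
    QuaternionAlgebra.ext_iff.symm

/-- The quaternion with a given coefficient 4-tuple. -/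
def ofCoords {R : Type*} [Zero R] [One R] [Neg R] (w : Fin 4 → R) : ℍ[R] := ⟨w 0, w 1, w 2, w 3⟩

/-- The ring homomorphism of quaternion rings obtained by applying a ring homomorphism to
the coefficients. -/
def mapCoeff {R S : Type*} [CommRing R] [CommRing S] (f : R →+* S) : ℍ[R] →+* ℍ[S] where
  toFun x := ⟨f x.re, f x.imI, f x.imJ, f x.imK⟩
  map_zero' := by ext <;> simp
  map_one' := by ext <;> simp
  map_add' _ _ := QuaternionAlgebra.ext (map_add f _ _) (map_add f _ _) (map_add f _ _)
    (map_add f _ _)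
  map_mul' x y := by
    refine QuaternionAlgebra.ext (Eq.trans ?_ (re_mul _ _).symm)
      (Eq.trans ?_ (imI_mul _ _).symm) (Eq.trans ?_ (imJ_mul _ _).symm)
      (Eq.trans ?_ (imK_mul _ _).symm) <;> simp

section

variable {R S : Type*} [CommRing R] [CommRing S] (f : R →+* S)

theorem mapCoeff_injective (hf : Function.Injective f) : Function.Injective (mapCoeff f) := by
  intro x y h
  obtain ⟨h0, h1, h2, h3⟩ := QuaternionAlgebra.ext_iff.1 h
  exact QuaternionAlgebra.ext (hf h0) (hf h1) (hf h2) (hf h3)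

theorem normSq_mapCoeff (x : ℍ[R]) : normSq (mapCoeff f x) = f (normSq x) := by
  rw [normSq_def', normSq_def', map_add, map_add, map_add, map_pow, map_pow, map_pow, map_pow]
  rfl

theorem mapCoeff_ofCoords (w : Fin 4 → R) : mapCoeff f (ofCoords w) = ofCoords (f ∘ w) := rfl

end

theorem coords_eq_iff (q : ℍ[ℝ]) (w : Fin 4 → ℝ) :
    coords q = w ↔ ofCoords (fun n => 2 * w n) = 2 * q := by
  have h : (2 : ℍ[ℝ]) * q = ofCoords (fun n => 2 * coords q n) := by
    rw [two_mul]
    ext <;> simp [ofCoords, coords, two_mul]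
  rw [h]
  refine ⟨fun e => by rw [e], fun e => ?_⟩
  obtain ⟨h0, h1, h2, h3⟩ := QuaternionAlgebra.ext_iff.1 e
  simp only [ofCoords] at h0 h1 h2 h3
  funext n
  fin_cases n <;> simp <;> linarith

end Quaternion

namespace SixHundredCell

/-- The double of the unit `ε e_n`, where `e` is the basis `1, i, j, k`. -/
def axisUnit (x : ℤˣ × Fin 4) : ℍ[GoldenInt] := ofCoords (Pi.single x.2 ⟨2 * x.1, 0⟩)

/-- The double of the unit `½(ε₀ + ε₁ i + ε₂ j + ε₃ k)`. -/
def halfUnit (ε : Fin 4 → ℤˣ) : ℍ[GoldenInt] := ofCoords fun n => ⟨ε n, 0⟩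

/-- The double of the quaternion with coefficients a permutation of
`(ε₀ φ/2, ε₁/2, ε₂/(2φ), 0)`. -/
def goldenUnit (x : (Fin 3 → ℤˣ) × Equiv.Perm (Fin 4)) : ℍ[GoldenInt] :=
  ofCoords (![⟨0, x.1 0⟩, ⟨x.1 1, 0⟩, ⟨-x.1 2, x.1 2⟩, 0] ∘ x.2)

/-- The doubles of the Hurwitz units. -/
def doubledHurwitz : Finset ℍ[GoldenInt] :=
  Finset.univ.image axisUnit ∪ Finset.univ.image halfUnit

/-- The doubles of the vertices of the 600-cell. -/
def doubledVertices : Finset ℍ[GoldenInt] :=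
  doubledHurwitz ∪ (Finset.univ.filter fun x : (Fin 3 → ℤˣ) × Equiv.Perm (Fin 4) =>
    Equiv.Perm.sign x.2 = 1).image goldenUnit

/-- The double of `p600`. -/
def doubledP : ℍ[GoldenInt] := ofCoords ![⟨-1, 1⟩, ⟨0, 1⟩, 1, 0]

theorem normSq_sub_ne_of_mem_doubledHurwitz :
    ∀ t ∈ doubledHurwitz, ∀ t' ∈ doubledHurwitz, normSq (t - t') ≠ ⟨8, -4⟩ := by
  decide +kernel

theorem exists_vertex_of_mem_doubledHurwitz :
    ∀ k : Fin 5, ∀ t ∈ doubledHurwitz, ∃ v ∈ doubledVertices,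
      t * doubledP ^ (k : ℕ) = 2 ^ (k : ℕ) * v := by
  decide +kernel

theorem exists_coset_of_mem_doubledVertices :
    ∀ v ∈ doubledVertices, ∃ k : Fin 5, ∃ t ∈ doubledHurwitz,
      t * doubledP ^ (k : ℕ) = 2 ^ (k : ℕ) * v := by
  decide +kernel

theorem doubledHurwitz_mul_pow_ne :
    ∀ k l : Fin 5, k < l → ∀ t ∈ doubledHurwitz, ∀ t' ∈ doubledHurwitz,
      2 ^ (l : ℕ) * (t * doubledP ^ (k : ℕ)) ≠ 2 ^ (k : ℕ) * (t' * doubledP ^ (l : ℕ)) := by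
  decide +kernel

/-- The embedding of the quaternions over `ℤ[φ]` into the real quaternions. -/
noncomputable abbrev toReal : ℍ[GoldenInt] →+* ℍ[ℝ] := mapCoeff GoldenInt.toReal

theorem toReal_injective : Function.Injective toReal :=
  mapCoeff_injective _ GoldenInt.toReal_injective

theorem isSign_iff (x : ℝ) : IsSign x ↔ ∃ u : ℤˣ, ((u : ℤ) : ℝ) = x := by
  constructor
  · rintro (rfl | rfl)
    exacts [⟨1, by simp⟩, ⟨-1, by simp⟩]
  · rintro ⟨u, rfl⟩
    rcases Int.units_eq_one_or u with rfl | rfl <;> simp [IsSign]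

theorem toReal_axisUnit_eq_iff (u : ℤˣ) (n : Fin 4) (q : ℍ[ℝ]) :
    toReal (axisUnit (u, n)) = 2 * q ↔ coords q = Pi.single n ((u : ℤ) : ℝ) := by
  rw [coords_eq_iff, axisUnit, mapCoeff_ofCoords]
  congr! 2
  funext m
  by_cases h : m = n
  · subst h
    simp [GoldenInt.toReal_apply]
  · simp [h, GoldenInt.toReal_apply]

theorem toReal_halfUnit_eq_iff (ε : Fin 4 → ℤˣ) (q : ℍ[ℝ]) :
    toReal (halfUnit ε) = 2 * q ↔ coords q = fun n => ((ε n : ℤ) : ℝ) / 2 := by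
  rw [coords_eq_iff, halfUnit, mapCoeff_ofCoords]
  congr! 2
  funext m
  simp [GoldenInt.toReal_apply]
  ring

theorem toReal_goldenUnit_eq_iff (ε : Fin 3 → ℤˣ) (σ : Equiv.Perm (Fin 4)) (q : ℍ[ℝ]) :
    toReal (goldenUnit (ε, σ)) = 2 * q ↔ coords q =
      ![((ε 0 : ℤ) : ℝ) * gr / 2, ((ε 1 : ℤ) : ℝ) / 2, ((ε 2 : ℤ) : ℝ) / (2 * gr), 0] ∘ σ := by
  rw [coords_eq_iff, goldenUnit, mapCoeff_ofCoords]
  congr! 2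
  funext m
  simp only [Function.comp_apply]
  generalize σ m = j
  fin_cases j
  · simp [GoldenInt.toReal_apply]
    ring
  · simp [GoldenInt.toReal_apply]
    ring
  · simp [GoldenInt.toReal_apply, div_eq_mul_inv, GoldenInt.inv_gr]
    ring
  · simp

theorem exists_axisUnit_iff (q : ℍ[ℝ]) :
    (∃ x, toReal (axisUnit x) = 2 * q) ↔ ∃ ε : ℝ, IsSign ε ∧
      (coords q = ![ε, 0, 0, 0] ∨ coords q = ![0, ε, 0, 0] ∨
       coords q = ![0, 0, ε, 0] ∨ coords q = ![0, 0, 0, ε]) := by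
  have h (ε : ℝ) : (coords q = ![ε, 0, 0, 0] ∨ coords q = ![0, ε, 0, 0] ∨
      coords q = ![0, 0, ε, 0] ∨ coords q = ![0, 0, 0, ε]) ↔
      ∃ n : Fin 4, coords q = Pi.single n ε := by
    have h0 : Pi.single 0 ε = ![ε, 0, 0, 0] := by funext m; fin_cases m <;> simp
    have h1 : Pi.single 1 ε = ![0, ε, 0, 0] := by funext m; fin_cases m <;> simp
    have h2 : Pi.single 2 ε = ![0, 0, ε, 0] := by funext m; fin_cases m <;> simp
    have h3 : Pi.single 3 ε = ![0, 0, 0, ε] := by funext m; fin_cases m <;> simp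
    simp [Fin.exists_fin_succ, ← h0, ← h1, ← h2, ← h3]
  simp only [Prod.exists, toReal_axisUnit_eq_iff, h, isSign_iff, exists_exists_eq_and]

theorem exists_halfUnit_iff (q : ℍ[ℝ]) :
    (∃ ε, toReal (halfUnit ε) = 2 * q) ↔
      ∃ ε₀ ε₁ ε₂ ε₃ : ℝ, IsSign ε₀ ∧ IsSign ε₁ ∧ IsSign ε₂ ∧ IsSign ε₃ ∧
        coords q = ![ε₀ / 2, ε₁ / 2, ε₂ / 2, ε₃ / 2] := by
  simp only [toReal_halfUnit_eq_iff, isSign_iff]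
  constructor
  · rintro ⟨ε, h⟩
    refine ⟨_, _, _, _, ⟨ε 0, rfl⟩, ⟨ε 1, rfl⟩, ⟨ε 2, rfl⟩, ⟨ε 3, rfl⟩, h.trans ?_⟩
    funext m
    fin_cases m <;> rfl
  · rintro ⟨_, _, _, _, ⟨a, rfl⟩, ⟨b, rfl⟩, ⟨c, rfl⟩, ⟨d, rfl⟩, h⟩
    refine ⟨![a, b, c, d], h.trans ?_⟩
    funext m
    fin_cases m <;> rfl

theorem exists_goldenUnit_iff (q : ℍ[ℝ]) :
    (∃ x, Equiv.Perm.sign x.2 = 1 ∧ toReal (goldenUnit x) = 2 * q) ↔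
      ∃ ε₁ ε₂ ε₃ : ℝ, IsSign ε₁ ∧ IsSign ε₂ ∧ IsSign ε₃ ∧
        ∃ σ : Equiv.Perm (Fin 4), Equiv.Perm.sign σ = 1 ∧
          coords q = ![ε₁ * gr / 2, ε₂ / 2, ε₃ / (2 * gr), 0] ∘ σ := by
  simp only [Prod.exists, toReal_goldenUnit_eq_iff, isSign_iff]
  constructor
  · rintro ⟨ε, σ, hσ, h⟩
    exact ⟨_, _, _, ⟨ε 0, rfl⟩, ⟨ε 1, rfl⟩, ⟨ε 2, rfl⟩, σ, hσ, h⟩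
  · rintro ⟨_, _, _, ⟨a, rfl⟩, ⟨b, rfl⟩, ⟨c, rfl⟩, σ, hσ, h⟩
    exact ⟨![a, b, c], σ, hσ, h⟩

theorem mem_hurwitzUnits_iff (q : ℍ[ℝ]) :
    q ∈ hurwitzUnits ↔ ∃ t ∈ doubledHurwitz, toReal t = 2 * q := by
  simp only [doubledHurwitz, Finset.mem_union, Finset.mem_image, Finset.mem_univ, true_and,
    or_and_right, exists_or, exists_exists_eq_and, exists_axisUnit_iff, exists_halfUnit_iff]
  rfl

theorem mem_V600_iff (q : ℍ[ℝ]) :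
    q ∈ V600 ↔ ∃ v ∈ doubledVertices, toReal v = 2 * q := by
  simp only [doubledVertices, Finset.mem_union, Finset.mem_image, Finset.mem_filter,
    Finset.mem_univ, true_and, or_and_right, exists_or, ← mem_hurwitzUnits_iff,
    exists_exists_and_eq_and, exists_goldenUnit_iff]
  exact or_assoc.symm

theorem toReal_doubledP : toReal doubledP = 2 * p600 := by
  rw [← (coords_eq_iff p600 (coords p600)).1 rfl, doubledP, mapCoeff_ofCoords]
  congr 1
  funext n
  fin_cases n <;>
    simp [coords, p600, map_one, map_zero, GoldenInt.toReal_mk, GoldenInt.inv_gr] <;> ring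

theorem two_eq_coe : (2 : ℍ[ℝ]) = ((2 : ℝ) : ℍ[ℝ]) := QuaternionAlgebra.coe_ofNat.symm

theorem two_ne_zero : (2 : ℍ[ℝ]) ≠ 0 := by
  rw [two_eq_coe, ← Quaternion.coe_zero, Ne, Quaternion.coe_inj]
  norm_num

theorem norm_two : ‖(2 : ℍ[ℝ])‖ = 2 := by
  rw [two_eq_coe, Quaternion.norm_coe]
  norm_num

theorem toReal_mul_doubledP_pow {t : ℍ[GoldenInt]} {q : ℍ[ℝ]} (h : toReal t = 2 * q) (k : ℕ) :
    toReal (t * doubledP ^ k) = 2 ^ k * (2 * (q * p600 ^ k)) := by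
  have h2 : Commute (2 : ℍ[ℝ]) p600 := .ofNat_left 2 p600
  have hq : Commute (2 ^ k : ℍ[ℝ]) (2 * q) :=
    .pow_left (.mul_right (.refl 2) (.ofNat_left 2 q)) k
  rw [map_mul, map_pow, toReal_doubledP, h, h2.mul_pow, ← mul_assoc, ← hq.eq, mul_assoc, mul_assoc]

theorem mul_doubledP_pow_eq_iff {t v : ℍ[GoldenInt]} {q r : ℍ[ℝ]} (hq : toReal t = 2 * q)
    (hr : toReal v = 2 * r) (k : ℕ) :
    t * doubledP ^ k = 2 ^ k * v ↔ q * p600 ^ k = r := by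
  rw [← toReal_injective.eq_iff, toReal_mul_doubledP_pow hq, map_mul, map_pow, map_ofNat, hr,
    mul_right_inj' (pow_ne_zero _ two_ne_zero), mul_right_inj' two_ne_zero]

theorem exists_toReal_eq_two_mul (v : ℍ[GoldenInt]) : ∃ q : ℍ[ℝ], toReal v = 2 * q :=
  ⟨2⁻¹ * toReal v, (mul_inv_cancel_left₀ two_ne_zero _).symm⟩

theorem norm_p600 : ‖p600‖ = 1 := by
  have h : ‖p600‖ * ‖p600‖ = 1 := by
    rw [← normSq_eq_norm_mul_self, normSq_def', p600]
    simp only [GoldenInt.inv_gr]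
    linear_combination (1 / 2) * GoldenInt.gr_mul_self
  nlinarith [norm_nonneg p600]

theorem disjoint_coset600_of_lt {k l : Fin 5} (h : k < l) :
    Disjoint (coset600 k) (coset600 l) := by
  rw [Set.disjoint_left]
  rintro _ ⟨s, hs, rfl⟩ ⟨s', hs', he⟩
  obtain ⟨t, ht, hts⟩ := (mem_hurwitzUnits_iff s).1 hs
  obtain ⟨t', ht', hts'⟩ := (mem_hurwitzUnits_iff s').1 hs'
  refine doubledHurwitz_mul_pow_ne k l h t ht t' ht' (toReal_injective ?_)
  simp only at he
  rw [map_mul toReal (2 ^ _), map_mul toReal (2 ^ _), toReal_mul_doubledP_pow hts, toReal_mul_doubledP_pow hts', he, map_pow,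
    map_pow, map_ofNat,
    ← mul_assoc (2 ^ _) (2 ^ _), ← mul_assoc (2 ^ _) (2 ^ _), ← pow_add, ← pow_add, add_comm]

theorem iUnion_coset600 : (⋃ k : Fin 5, coset600 k) = V600 := by
  ext q
  rw [Set.mem_iUnion, mem_V600_iff]
  constructor
  · rintro ⟨k, s, hs, rfl⟩
    obtain ⟨t, ht, hts⟩ := (mem_hurwitzUnits_iff s).1 hs
    obtain ⟨v, hv, htv⟩ := exists_vertex_of_mem_doubledHurwitz k t ht
    obtain ⟨r, hr⟩ := exists_toReal_eq_two_mul v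
    exact ⟨v, hv, hr.trans (congrArg (2 * ·) ((mul_doubledP_pow_eq_iff hts hr k).1 htv).symm)⟩
  · rintro ⟨v, hv, hq⟩
    obtain ⟨k, t, ht, htv⟩ := exists_coset_of_mem_doubledVertices v hv
    obtain ⟨s, hs⟩ := exists_toReal_eq_two_mul t
    exact ⟨k, s, (mem_hurwitzUnits_iff s).2 ⟨t, ht, hs⟩, (mul_doubledP_pow_eq_iff hs hq k).1 htv⟩

theorem norm_sub_ne_of_mem_hurwitzUnits {s s' : ℍ[ℝ]} (hs : s ∈ hurwitzUnits)
    (hs' : s' ∈ hurwitzUnits) : ‖s - s'‖ ≠ gr - 1 := by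
  obtain ⟨t, ht, hts⟩ := (mem_hurwitzUnits_iff s).1 hs
  obtain ⟨t', ht', hts'⟩ := (mem_hurwitzUnits_iff s').1 hs'
  intro h
  refine normSq_sub_ne_of_mem_doubledHurwitz t ht t' ht' (GoldenInt.toReal_injective ?_)
  rw [← normSq_mapCoeff, map_sub, hts, hts', ← mul_sub, normSq_eq_norm_mul_self, norm_mul, h,
    norm_two, GoldenInt.toReal_apply]
  push_cast
  linear_combination 4 * GoldenInt.gr_mul_self

theorem norm_sub_ne_of_mem_coset600 {k : Fin 5} {x y : ℍ[ℝ]} (hx : x ∈ coset600 k)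
    (hy : y ∈ coset600 k) : ‖x - y‖ ≠ gr - 1 := by
  obtain ⟨s, hs, rfl⟩ := hx
  obtain ⟨s', hs', rfl⟩ := hy
  simp only
  rw [← sub_mul, norm_mul, norm_pow, norm_p600, one_pow, mul_one]
  exact norm_sub_ne_of_mem_hurwitzUnits hs hs'

end SixHundredCell

open SixHundredCell

/-- The five sets `𝒯·p^k` (k = 0,…,4) are pairwise disjoint, their union is the vertex set
of the 600-cell, and each is an independent set of the 600-cell graph; consequently,
assigning to each vertex the unique `k` with `v ∈ 𝒯·p^k` is a proper 5-coloring. -/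
theorem hurwitz_cosets_color_six_hundred_cell :
    (∀ k l : Fin 5, k ≠ l → Disjoint (coset600 k) (coset600 l)) ∧
    (⋃ k : Fin 5, coset600 k) = V600 ∧
    (∀ k : Fin 5, ∀ x ∈ coset600 k, ∀ y ∈ coset600 k, x ≠ y → ‖x - y‖ ≠ gr - 1) ∧
    ∃ f : V600 → Fin 5, (∀ v : V600, (v : Quaternion ℝ) ∈ coset600 (f v)) ∧
      ∀ q q' : V600, sigma600.Adj q q' → f q ≠ f q' := by
  refine ⟨fun k l hkl => ?_, iUnion_coset600,
    fun k x hx y hy _ => norm_sub_ne_of_mem_coset600 hx hy, ?_⟩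
  · rcases hkl.lt_or_gt with h | h
    exacts [disjoint_coset600_of_lt h, (disjoint_coset600_of_lt h).symm]
  · have hf (v : V600) : ∃ k, (v : ℍ[ℝ]) ∈ coset600 k :=
      Set.mem_iUnion.1 (iUnion_coset600.symm ▸ v.2)
    choose f hf using hf
    refine ⟨f, hf, fun q q' hadj he => ?_⟩
    have hq' := he ▸ hf q'
    rcases ((SimpleGraph.fromRel_adj _ _ _).1 hadj).2 with h | h
    exacts [norm_sub_ne_of_mem_coset600 (hf q) hq' h, norm_sub_ne_of_mem_coset600 hq' (hf q) h]
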